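/- Let A₀ be a type I von Neumann algebra with completely atomic center, identified with a direct sum ⊕_k B(H_k), and let (ψ_n) be a sequence of normal states on A₀ converging to a normal state ψ in the weak* topology induced by A₀ (i.e. ψ_n(x) → ψ(x) for all x ∈ A₀). Then ‖ψ_n - ψ‖ → 0 in the predual norm. -/

import Mathlib

open Filter Topology
open scoped InnerProductSpace

/-- The value at a (block-diagonal) operator `x` of the normal state on `⊕_k B(H_k)`
represented by the square-summable family of vectors `v k i ∈ H k`:
`ψ_v(x) = ∑_{k,i} ⟪v k i, x_k (v k i)⟫`. -/
noncomputable def normalStateValue {ι : Type*} (H : ι → Type*)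
    [∀ k, NormedAddCommGroup (H k)] [∀ k, InnerProductSpace ℂ (H k)]
    (v : ∀ k, ℕ → H k) (x : ∀ k, H k →L[ℂ] H k) : ℂ :=
  ∑' p : ι × ℕ, ⟪v p.1 p.2, x p.1 (v p.1 p.2)⟫_ℂ

section Helpers

variable {ι : Type*} {H : ι → Type*}
    [∀ k, NormedAddCommGroup (H k)] [∀ k, InnerProductSpace ℂ (H k)]

lemma nsv_summable (v : ∀ k, ℕ → H k)
    (hv : Summable (fun p : ι × ℕ => ‖v p.1 p.2‖ ^ 2))
    (x : ∀ k, H k →L[ℂ] H k) (C : ℝ) (hx : ∀ k, ‖x k‖ ≤ C) :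
    Summable (fun p : ι × ℕ => ⟪v p.1 p.2, x p.1 (v p.1 p.2)⟫_ℂ) := by
  refine Summable.of_norm_bounded (hv.mul_left C) fun p => ?_
  calc _ ≤ ‖v p.1 p.2‖ * ‖x p.1 (v p.1 p.2)‖ := norm_inner_le_norm _ _
    _ ≤ ‖v p.1 p.2‖ * (C * ‖v p.1 p.2‖) := by
        gcongr
        exact (x p.1).le_of_opNorm_le (hx _) _
    _ = _ := by ring

lemma nsv_sum {τ : Type*} (T : Finset τ) (v : ∀ k, ℕ → H k)
    (hv : Summable (fun p : ι × ℕ => ‖v p.1 p.2‖ ^ 2))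
    (c : τ → ℂ) (E : τ → ∀ k, H k →L[ℂ] H k) (hE : ∀ t, ∃ C : ℝ, ∀ k, ‖E t k‖ ≤ C) :
    normalStateValue H v (∑ t ∈ T, c t • E t) = ∑ t ∈ T, c t * normalStateValue H v (E t) := by
  unfold normalStateValue
  have hs : ∀ t, Summable (fun p : ι × ℕ => ⟪v p.1 p.2, E t p.1 (v p.1 p.2)⟫_ℂ) := fun t => by
    obtain ⟨C, hC⟩ := hE t
    exact nsv_summable v hv (E t) C hC
  simp_rw [← tsum_mul_left]
  rw [← Summable.tsum_finsetSum (fun t _ => (hs t).mul_left (c t))]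
  refine tsum_congr fun p => ?_
  simp [Finset.sum_apply, ContinuousLinearMap.sum_apply, inner_sum, inner_smul_right]

lemma nsv_compl (V : ∀ k, Submodule ℂ (H k)) [∀ k, (V k).HasOrthogonalProjection]
    (v : ∀ k, ℕ → H k) :
    normalStateValue H v (fun k => 1 - (V k).starProjection) =
      ((∑' p : ι × ℕ, ‖v p.1 p.2 - (V p.1).starProjection (v p.1 p.2)‖ ^ 2 : ℝ) : ℂ) := by
  unfold normalStateValue
  rw [Complex.ofReal_tsum]
  refine tsum_congr fun p => ?_
  have h := (V p.1).starProjection_inner_eq_zero (v p.1 p.2)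
    ((V p.1).starProjection (v p.1 p.2)) ((V p.1).starProjection_apply_mem _)
  have h' := inner_eq_zero_symm.1 h
  rw [Complex.ofReal_pow, ← Complex.coe_algebraMap, ← inner_self_eq_norm_sq_to_K]
  rw [inner_sub_left, h', sub_zero]
  rfl

lemma compl_summable (V : ∀ k, Submodule ℂ (H k)) [∀ k, (V k).HasOrthogonalProjection]
    (v : ∀ k, ℕ → H k) (hv : Summable (fun p : ι × ℕ => ‖v p.1 p.2‖ ^ 2)) :
    Summable (fun p : ι × ℕ => ‖v p.1 p.2 - (V p.1).starProjection (v p.1 p.2)‖ ^ 2) := by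
  refine Summable.of_nonneg_of_le (fun _ => by positivity) (fun p => ?_) hv
  have := (V p.1)ᗮ.norm_starProjection_apply_le (v p.1 p.2)
  rw [Submodule.starProjection_orthogonal_val] at this
  gcongr

lemma nsv_compress (V : ∀ k, Submodule ℂ (H k)) [∀ k, (V k).HasOrthogonalProjection]
    (v : ∀ k, ℕ → H k) (hv : Summable (fun p : ι × ℕ => ‖v p.1 p.2‖ ^ 2))
    (h1 : ∑' p : ι × ℕ, ‖v p.1 p.2‖ ^ 2 = 1) (η : ℝ) (hη : 0 < η)
    (hδ : ∑' p : ι × ℕ, ‖v p.1 p.2 - (V p.1).starProjection (v p.1 p.2)‖ ^ 2 ≤ η ^ 2)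
    (x : ∀ k, H k →L[ℂ] H k) (hx : ∀ k, ‖x k‖ ≤ 1) :
    ‖normalStateValue H v x - normalStateValue H v
      (fun k => (V k).starProjection ∘L x k ∘L (V k).starProjection)‖ ≤ 2 * η := by
  have hP : ∀ k, ‖(V k).starProjection ∘L x k ∘L (V k).starProjection‖ ≤ 1 := fun k => by
    refine ContinuousLinearMap.opNorm_le_bound _ zero_le_one fun w => ?_
    calc _ ≤ ‖x k ((V k).starProjection w)‖ := (V k).norm_starProjection_apply_le _
      _ ≤ 1 * ‖(V k).starProjection w‖ := (x k).le_of_opNorm_le (hx k) _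
      _ ≤ _ := by gcongr; exact (V k).norm_starProjection_apply_le _
  have s1 := nsv_summable v hv x 1 hx
  have s2 := nsv_summable v hv _ 1 hP
  have s3 := compl_summable V v hv
  unfold normalStateValue
  rw [← s1.tsum_sub s2]
  have key : ∀ p : ι × ℕ, ‖⟪v p.1 p.2, x p.1 (v p.1 p.2)⟫_ℂ - ⟪v p.1 p.2,
      ((V p.1).starProjection ∘L x p.1 ∘L (V p.1).starProjection) (v p.1 p.2)⟫_ℂ‖ ≤
      η⁻¹ * ‖v p.1 p.2 - (V p.1).starProjection (v p.1 p.2)‖ ^ 2 + η * ‖v p.1 p.2‖ ^ 2 := by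
    intro p
    set w := v p.1 p.2
    set u := (V p.1).starProjection w with hu
    have e : ⟪w, x p.1 w⟫_ℂ - ⟪w,
      ((V p.1).starProjection ∘L x p.1 ∘L (V p.1).starProjection) w⟫_ℂ
        = ⟪w - u, x p.1 w⟫_ℂ + ⟪u, x p.1 (w - u)⟫_ℂ := by
      simp only [ContinuousLinearMap.comp_apply]
      rw [← Submodule.inner_starProjection_left_eq_right, ← hu, map_sub, inner_sub_left,
        inner_sub_right]
      ring
    rw [e]
    have hu' : ‖u‖ ≤ ‖w‖ := (V p.1).norm_starProjection_apply_le _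
    have a1 : ‖⟪w - u, x p.1 w⟫_ℂ‖ ≤ ‖w - u‖ * ‖w‖ := by
      refine (norm_inner_le_norm _ _).trans ?_
      gcongr
      simpa using (x p.1).le_of_opNorm_le (hx _) w
    have a2 : ‖⟪u, x p.1 (w - u)⟫_ℂ‖ ≤ ‖w‖ * ‖w - u‖ := by
      refine (norm_inner_le_norm _ _).trans ?_
      gcongr
      simpa using (x p.1).le_of_opNorm_le (hx _) (w - u)
    refine (norm_add_le _ _).trans ((add_le_add a1 a2).trans ?_)
    have : η⁻¹ * ‖w - u‖ ^ 2 + η * ‖w‖ ^ 2 - (‖w - u‖ * ‖w‖ + ‖w‖ * ‖w - u‖)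
        = η⁻¹ * (‖w - u‖ - η * ‖w‖) ^ 2 := by
      field_simp
      ring
    have h0 : 0 ≤ η⁻¹ * (‖w - u‖ - η * ‖w‖) ^ 2 := by positivity
    linarith
  have s4 := (s3.mul_left η⁻¹).add (hv.mul_left η)
  refine (tsum_of_norm_bounded s4.hasSum key).trans ?_
  rw [(s3.mul_left η⁻¹).tsum_add (hv.mul_left η), tsum_mul_left, tsum_mul_left, h1]
  have : η⁻¹ * ∑' p : ι × ℕ, ‖v p.1 p.2 - (V p.1).starProjection (v p.1 p.2)‖ ^ 2
      ≤ η⁻¹ * η ^ 2 := by gcongr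
  have h2 : η⁻¹ * η ^ 2 = η := by field_simp
  linarith

open Classical in
/-- The matrix unit in block `k`. -/
noncomputable def matUnit (V : ∀ k, Submodule ℂ (H k)) [∀ k, FiniteDimensional ℂ (V k)]
    (t : Σ k, Fin (Module.finrank ℂ (V k)) × Fin (Module.finrank ℂ (V k))) :
    ∀ k, H k →L[ℂ] H k :=
  Pi.single t.1 (InnerProductSpace.rankOne ℂ (stdOrthonormalBasis ℂ (V t.1) t.2.1 : H t.1)
    (stdOrthonormalBasis ℂ (V t.1) t.2.2 : H t.1))

lemma matUnit_bdd (V : ∀ k, Submodule ℂ (H k)) [∀ k, FiniteDimensional ℂ (V k)]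
    (t : Σ k, Fin (Module.finrank ℂ (V k)) × Fin (Module.finrank ℂ (V k))) :
    ∃ C : ℝ, ∀ k, ‖matUnit V t k‖ ≤ C := by
  refine ⟨‖matUnit V t t.1‖, fun k => ?_⟩
  by_cases h : k = t.1
  · subst h; rfl
  · have : matUnit V t k = 0 := by simp [matUnit, h]
    rw [this]; simp

lemma compress_eq_sum (V : ∀ k, Submodule ℂ (H k)) [∀ k, FiniteDimensional ℂ (V k)]
    (F : Finset ι) (hF : ∀ k, k ∉ F → V k = ⊥) (x : ∀ k, H k →L[ℂ] H k) :
    (fun k => (V k).starProjection ∘L x k ∘L (V k).starProjection) =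
      ∑ t ∈ F.sigma (fun k => (Finset.univ :
          Finset (Fin (Module.finrank ℂ (V k)) × Fin (Module.finrank ℂ (V k))))),
        ⟪(stdOrthonormalBasis ℂ (V t.1) t.2.1 : H t.1),
          x t.1 (stdOrthonormalBasis ℂ (V t.1) t.2.2 : H t.1)⟫_ℂ • matUnit V t := by
  classical
  funext k
  rw [Finset.sum_apply, Finset.sum_sigma]
  by_cases hk : k ∈ F
  · rw [Finset.sum_eq_single_of_mem k hk]
    · ext w
      rw [(stdOrthonormalBasis ℂ (V k)).starProjection_eq_sum_rankOne]
      simp only [ContinuousLinearMap.comp_apply, ContinuousLinearMap.sum_apply, Pi.smul_apply,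
        InnerProductSpace.rankOne_apply, matUnit, Pi.single_eq_same, map_sum, map_smul,
        inner_sum, inner_smul_right, Fintype.sum_prod_type, ContinuousLinearMap.smul_apply,
        Finset.sum_smul, smul_smul]
      rw [Finset.sum_comm]
      simp only [mul_comm, Finset.smul_sum, smul_smul]
    · intro b _ hb
      refine Finset.sum_eq_zero fun t _ => ?_
      simp [matUnit, hb.symm]
  · rw [Finset.sum_eq_zero]
    · ext w
      have : (V k).starProjection w = 0 := by
        have h := (V k).starProjection_apply_mem w
        exact (Submodule.mem_bot ℂ).1 ((hF k hk).le h)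
      simp [this]
    · intro b hb
      refine Finset.sum_eq_zero fun t _ => ?_
      have : k ≠ b := fun h => hk (h ▸ hb)
      simp [matUnit, this]

end Helpers

/-- Dell'Antonio's theorem for a type I von Neumann algebra `A₀ = ⊕_k B(H_k)` with
completely atomic center: if a sequence of normal states (represented by square-summable
families of vectors, normalized to total weight one) converges to a normal state in the
weak* topology induced by `A₀`, then it converges in the predual norm, i.e. uniformly on
the unit ball of `A₀`. -/
theorem stmt19 {ι : Type*} [Countable ι] (H : ι → Type*)
    [∀ k, NormedAddCommGroup (H k)] [∀ k, InnerProductSpace ℂ (H k)]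
    [∀ k, CompleteSpace (H k)] [∀ k, TopologicalSpace.SeparableSpace (H k)]
    (g : ℕ → ∀ k, ℕ → H k) (g' : ∀ k, ℕ → H k)
    (hgsum : ∀ n, Summable (fun p : ι × ℕ => ‖g n p.1 p.2‖ ^ 2))
    (hgnorm : ∀ n, ∑' p : ι × ℕ, ‖g n p.1 p.2‖ ^ 2 = 1)
    (hg'sum : Summable (fun p : ι × ℕ => ‖g' p.1 p.2‖ ^ 2))
    (hg'norm : ∑' p : ι × ℕ, ‖g' p.1 p.2‖ ^ 2 = 1)
    (hweak : ∀ x : ∀ k, H k →L[ℂ] H k, (∃ C : ℝ, ∀ k, ‖x k‖ ≤ C) →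
      Tendsto (fun n => normalStateValue H (g n) x) atTop
        (𝓝 (normalStateValue H g' x))) :
    ∀ ε : ℝ, 0 < ε → ∃ N : ℕ, ∀ n ≥ N, ∀ x : ∀ k, H k →L[ℂ] H k,
      (∀ k, ‖x k‖ ≤ 1) →
      ‖normalStateValue H (g n) x - normalStateValue H g' x‖ ≤ ε := by
  classical
  intro ε hε
  set η : ℝ := ε / 8 with hη
  have hη0 : 0 < η := by positivity
  -- choice of a finite set carrying almost all the mass of `g'`
  obtain ⟨S, hS⟩ : ∃ S : Finset (ι × ℕ), 1 - η ^ 2 < ∑ p ∈ S, ‖g' p.1 p.2‖ ^ 2 := by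
    have h := hg'sum.hasSum
    rw [hg'norm] at h
    exact (h.eventually (lt_mem_nhds (by nlinarith : (1 : ℝ) - η ^ 2 < 1))).exists
  let V : ∀ k, Submodule ℂ (H k) := fun k => Submodule.span ℂ ((g' k) '' {i | (k, i) ∈ S})
  have hfin : ∀ k, FiniteDimensional ℂ (V k) := fun k => by
    refine FiniteDimensional.span_of_finite ℂ (Set.Finite.image _ ?_)
    exact S.finite_toSet.preimage (Prod.mk_right_injective k).injOn
  let F : Finset ι := S.image Prod.fst
  have hF : ∀ k, k ∉ F → V k = ⊥ := fun k hk => by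
    have : {i | (k, i) ∈ S} = ∅ := by
      ext i
      simp only [Set.mem_setOf_eq, Set.mem_empty_iff_false, iff_false]
      exact fun h => hk (Finset.mem_image.2 ⟨_, h, rfl⟩)
    simp [V, this]
  have hmass : ∑' p : ι × ℕ, ‖g' p.1 p.2 - (V p.1).starProjection (g' p.1 p.2)‖ ^ 2 < η ^ 2 := by
    have hz : ∀ p ∈ S, ‖g' p.1 p.2‖ ^ 2 +
        ‖g' p.1 p.2 - (V p.1).starProjection (g' p.1 p.2)‖ ^ 2 ≤ ‖g' p.1 p.2‖ ^ 2 := by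
      intro p hp
      have : (V p.1).starProjection (g' p.1 p.2) = g' p.1 p.2 :=
        Submodule.starProjection_eq_self_iff.2 (Submodule.subset_span ⟨p.2, hp, rfl⟩)
      simp [this]
    have hs := compl_summable V g' hg'sum
    have hi : ∀ p : ι × ℕ, ‖g' p.1 p.2 - (V p.1).starProjection (g' p.1 p.2)‖ ^ 2 ≤
        ‖g' p.1 p.2‖ ^ 2 - (if p ∈ S then ‖g' p.1 p.2‖ ^ 2 else 0) := by
      intro p
      split_ifs with hp
      · linarith [hz p hp]
      · have := (V p.1)ᗮ.norm_starProjection_apply_le (g' p.1 p.2)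
        rw [Submodule.starProjection_orthogonal_val] at this
        rw [sub_zero]
        gcongr
    have hf : HasSum (fun p : ι × ℕ => if p ∈ S then ‖g' p.1 p.2‖ ^ 2 else 0)
        (∑ p ∈ S, ‖g' p.1 p.2‖ ^ 2) := by
      have := hasSum_sum_of_ne_finset_zero (s := S) (L := .unconditional _)
        (f := fun p : ι × ℕ => if p ∈ S then ‖g' p.1 p.2‖ ^ 2 else 0) (fun p hp => if_neg hp)
      rwa [Finset.sum_congr rfl (fun p hp => if_pos hp)] at this
    have h2 := hg'sum.hasSum.sub hf
    rw [hg'norm] at h2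
    have := hasSum_le hi hs.hasSum h2
    linarith
  -- the mass of `g n` outside is eventually small
  have hev1 : ∀ᶠ n in atTop,
      ∑' p : ι × ℕ, ‖g n p.1 p.2 - (V p.1).starProjection (g n p.1 p.2)‖ ^ 2 < η ^ 2 := by
    have h := hweak (fun k => 1 - (V k).starProjection) ⟨1, fun k => by
      have h := (V k)ᗮ.starProjection_norm_le
      rwa [Submodule.starProjection_orthogonal'] at h⟩
    simp only [nsv_compl V] at h
    have h' := (Complex.continuous_re.tendsto _).comp h
    simp only [Function.comp_def, Complex.ofReal_re] at h'
    exact h'.eventually (gt_mem_nhds hmass)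
  let T : Finset (Σ k, Fin (Module.finrank ℂ (V k)) × Fin (Module.finrank ℂ (V k))) :=
    F.sigma (fun k => Finset.univ)
  have hev2 : ∀ᶠ n in atTop, ∑ t ∈ T, ‖normalStateValue H (g n) (matUnit V t) -
      normalStateValue H g' (matUnit V t)‖ < ε / 2 := by
    have h : Tendsto (fun n => ∑ t ∈ T, ‖normalStateValue H (g n) (matUnit V t) -
      normalStateValue H g' (matUnit V t)‖) atTop (𝓝 (∑ t ∈ T, 0)) := by
      refine tendsto_finsetSum _ fun t _ => ?_
      exact tendsto_iff_norm_sub_tendsto_zero.1 (hweak _ (matUnit_bdd V t))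
    rw [Finset.sum_const_zero] at h
    exact h.eventually (gt_mem_nhds (by positivity))
  obtain ⟨N, hN⟩ := eventually_atTop.1 (hev1.and hev2)
  refine ⟨N, fun n hn x hx => ?_⟩
  obtain ⟨b1, b2⟩ := hN n hn
  have c1 := nsv_compress V (g n) (hgsum n) (hgnorm n) η hη0 b1.le x hx
  have c2 := nsv_compress V g' hg'sum hg'norm η hη0 hmass.le x hx
  have c3 : ‖normalStateValue H (g n)
        (fun k => (V k).starProjection ∘L x k ∘L (V k).starProjection) -
      normalStateValue H g'
        (fun k => (V k).starProjection ∘L x k ∘L (V k).starProjection)‖ ≤ ε / 2 := by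
    rw [compress_eq_sum V F hF x, nsv_sum _ _ (hgsum n) _ _ (matUnit_bdd V),
      nsv_sum _ _ hg'sum _ _ (matUnit_bdd V), ← Finset.sum_sub_distrib]
    refine (norm_sum_le _ _).trans (le_trans (Finset.sum_le_sum fun t _ => ?_) b2.le)
    rw [← mul_sub, norm_mul]
    refine mul_le_of_le_one_left (norm_nonneg _) ?_
    have e : ∀ a, ‖(stdOrthonormalBasis ℂ (V t.1) a : H t.1)‖ = 1 := fun a =>
      (stdOrthonormalBasis ℂ (V t.1)).orthonormal.1 a
    refine (norm_inner_le_norm _ _).trans ?_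
    rw [e, one_mul]
    refine ((x t.1).le_of_opNorm_le (hx _) _).trans ?_
    rw [e, one_mul]
  rw [norm_sub_rev] at c2
  have tri := norm_add₃_le (a := normalStateValue H (g n) x - normalStateValue H (g n)
        (fun k => (V k).starProjection ∘L x k ∘L (V k).starProjection))
    (b := normalStateValue H (g n)
        (fun k => (V k).starProjection ∘L x k ∘L (V k).starProjection) -
      normalStateValue H g'
        (fun k => (V k).starProjection ∘L x k ∘L (V k).starProjection))
    (c := normalStateValue H g'
        (fun k => (V k).starProjection ∘L x k ∘L (V k).starProjection) -
      normalStateValue H g' x)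
  rw [sub_add_sub_cancel, sub_add_sub_cancel] at tri
  linarith
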